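/- arXiv:2103.12108 — 8 statements merged into one kernel-verified Lean document; each statement's English description precedes it below -/
import Mathlib

section
/- Let γ ∈ ℝ with |γ| ≤ 2, and define F : ℂ → ℂ by F(z) = z/(1 + γz + z²). Then 1 + γz + z² ≠ 0 for all z in the open unit disc 𝔻 = {z ∈ ℂ : |z| < 1}, F is holomorphic on 𝔻, F(0) = 0, F'(0) = 1, and F is injective on 𝔻. -/
theorem one_add_mul_add_sq_ne_zero_of_norm_lt_one {γ : ℝ} (hγ : |γ| ≤ 2) {z : ℂ} (hz : ‖z‖ < 1) :
    1 + (γ : ℂ) * z + z ^ 2 ≠ 0 := by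
  intro h
  obtain ⟨hγ₁, hγ₂⟩ := abs_le.mp hγ
  have hsq : z.re * z.re + z.im * z.im < 1 := by
    rw [← Complex.normSq_apply, Complex.normSq_eq_norm_sq]
    nlinarith [norm_nonneg z]
  have hre := congrArg Complex.re h
  have him := congrArg Complex.im h
  simp [pow_two] at hre him
  have him' : z.im * (γ + 2 * z.re) = 0 := by linarith
  rcases mul_eq_zero.mp him' with hy | hx
  · rw [hy] at hre hsq
    have hlt : 0 < (1 + z.re) ^ 2 := by
      have : 0 < 1 + z.re := by nlinarith
      positivity
    have hlt' : 0 < (1 - z.re) ^ 2 := by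
      have : 0 < 1 - z.re := by nlinarith
      positivity
    have h₁ := mul_nonneg (by linarith : 0 ≤ 2 + γ) hlt.le
    have h₂ := mul_nonneg (by linarith : 0 ≤ 2 - γ) hlt'.le
    rcases le_total 0 γ with hg | hg <;> nlinarith
  · obtain rfl : γ = -2 * z.re := by linarith
    nlinarith

theorem injOn_div_one_add_mul_add_sq {γ : ℝ} (hγ : |γ| ≤ 2) :
    Set.InjOn (fun z : ℂ => z / (1 + (γ : ℂ) * z + z ^ 2)) (Metric.ball 0 1) := by
  intro z hz w hw h
  rw [mem_ball_zero_iff] at hz hw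
  rw [div_eq_div_iff (one_add_mul_add_sq_ne_zero_of_norm_lt_one hγ hz)
    (one_add_mul_add_sq_ne_zero_of_norm_lt_one hγ hw)] at h
  have hprod : (z - w) * (1 - z * w) = 0 := by linear_combination h
  rcases mul_eq_zero.mp hprod with h₀ | h₁
  · exact sub_eq_zero.mp h₀
  · have hnorm : ‖z‖ * ‖w‖ = 1 := by
      rw [← norm_mul, ← sub_eq_zero.mp h₁, norm_one]
    nlinarith [norm_nonneg z, norm_nonneg w]

/-- The normalized crossing-symmetric dispersion kernel `F(z) = z/(1+γz+z²)`
with `γ` real, `|γ| ≤ 2`, is well defined (the denominator never vanishes on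
the open unit disc), holomorphic on the disc, satisfies `F 0 = 0`,
`F' 0 = 1`, and is injective on the disc (i.e. `F` is schlicht). -/
theorem kernel_schlicht (γ : ℝ) (hγ : |γ| ≤ 2) :
    (∀ z ∈ Metric.ball (0 : ℂ) 1, 1 + (γ : ℂ) * z + z ^ 2 ≠ 0) ∧
    DifferentiableOn ℂ (fun z : ℂ => z / (1 + (γ : ℂ) * z + z ^ 2))
      (Metric.ball 0 1) ∧
    (fun z : ℂ => z / (1 + (γ : ℂ) * z + z ^ 2)) 0 = 0 ∧
    deriv (fun z : ℂ => z / (1 + (γ : ℂ) * z + z ^ 2)) 0 = 1 ∧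
    Set.InjOn (fun z : ℂ => z / (1 + (γ : ℂ) * z + z ^ 2))
      (Metric.ball 0 1) := by
  have hne : ∀ z ∈ Metric.ball (0 : ℂ) 1, 1 + (γ : ℂ) * z + z ^ 2 ≠ 0 := fun z hz =>
    one_add_mul_add_sq_ne_zero_of_norm_lt_one hγ (mem_ball_zero_iff.mp hz)
  refine ⟨hne, DifferentiableOn.div (by fun_prop) (by fun_prop) hne, by simp, ?_,
    injOn_div_one_add_mul_add_sq hγ⟩
  rw [deriv_fun_div (by fun_prop) (by fun_prop) (by simp)]
  simp
end

section
/- Let μ > 0 and a ∈ ℝ with a ≠ 0. Then the following are equivalent: (i) for every s ∈ ℝ with s ≥ 2μ/3, the quantity γ(a, s) := 27(a/s)²(1 − a/s) − 2 satisfies |γ(a, s)| < 2; (ii) a ∈ (−2μ/9, 0) ∪ (0, 4μ/9). -/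
theorem abs_cubic_lt_two_iff (x : ℝ) :
    |27 * x ^ 2 * (1 - x) - 2| < 2 ↔ x ≠ 0 ∧ x < 1 ∧ -1 / 3 < x ∧ x ≠ 2 / 3 := by
  have factor : 4 - 27 * x ^ 2 * (1 - x) = (3 * x - 2) ^ 2 * (3 * x + 1) := by ring
  rw [abs_lt]
  constructor
  · rintro ⟨hlow, hupp⟩
    have hpos : 0 < 27 * x ^ 2 * (1 - x) := by linarith
    have hpos' : 0 < (3 * x - 2) ^ 2 * (3 * x + 1) := by linarith
    refine ⟨?_, ?_, ?_, ?_⟩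
    · rintro rfl
      norm_num at hpos
    · linarith [pos_of_mul_pos_right hpos (by positivity)]
    · linarith [pos_of_mul_pos_right hpos' (by positivity)]
    · rintro rfl
      norm_num at hpos'
  · rintro ⟨h0, h1, h2, h3⟩
    have hpos : 0 < 27 * x ^ 2 * (1 - x) := mul_pos (by positivity) (by linarith)
    have hne : 3 * x - 2 ≠ 0 := fun h => h3 (by linarith)
    have hpos' : 0 < (3 * x - 2) ^ 2 * (3 * x + 1) := mul_pos (by positivity) (by linarith)
    constructor <;> linarith

/-- For `μ > 0` and real `a ≠ 0`, the condition `|γ(a,s)| < 2` for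
`γ(a,s) = 27(a/s)²(1 − a/s) − 2` and every `s ≥ 2μ/3` holds if and only if
`a ∈ (−2μ/9, 0) ∪ (0, 4μ/9)`. -/
theorem gamma_range (μ a : ℝ) (hμ : 0 < μ) (ha : a ≠ 0) :
    (∀ s : ℝ, 2 * μ / 3 ≤ s → |27 * (a / s) ^ 2 * (1 - a / s) - 2| < 2) ↔
      a ∈ Set.Ioo (-(2 * μ) / 9) 0 ∪ Set.Ioo 0 (4 * μ / 9) := by
  simp only [abs_cubic_lt_two_iff]
  constructor
  · intro h
    have hlow : -(2 * μ) / 9 < a := by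
      have := (h (2 * μ / 3) le_rfl).2.2.1
      rw [lt_div_iff₀ (by positivity)] at this
      linarith
    have hupp : a < 4 * μ / 9 := by
      by_contra! hle
      exact (h (3 * a / 2) (by linarith)).2.2.2 (by field_simp)
    rcases lt_or_gt_of_ne ha with hneg | hpos
    · exact Or.inl ⟨hlow, hneg⟩
    · exact Or.inr ⟨hpos, hupp⟩
  · intro h s hs
    have hs0 : 0 < s := by linarith
    have hlow : -(2 * μ) / 9 < a := by
      rcases h with h | h <;> linarith [h.1]
    have hupp : a < 4 * μ / 9 := by
      rcases h with h | h <;> linarith [h.2]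
    have hlt : a / s < 2 / 3 := by
      rw [div_lt_iff₀ hs0]
      linarith
    refine ⟨div_ne_zero ha hs0.ne', by linarith, ?_, hlt.ne⟩
    rw [lt_div_iff₀ hs0]
    linarith
end

section
/- Let μ > 0, let a ∈ ℝ with a ∈ (−2μ/9, 0) ∪ (0, 4μ/9), and let ν be a nonzero finite (positive) Borel measure on ℝ supported in [2μ/3, ∞). Then ∫ β₁(a, s) dν(s) < 0, where β₁(a, s) = 27a²(3a − 2s)/s³. -/
open MeasureTheory

/-- The integral of an almost everywhere negative integrable function against a nonzero measure is
negative. -/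
theorem integral_neg_of_ae_neg {α : Type*} [MeasurableSpace α] {ν : Measure α} (hν : ν ≠ 0)
    {f : α → ℝ} (hf : Integrable f ν) (hneg : ∀ᵐ x ∂ν, f x < 0) : ∫ x, f x ∂ν < 0 := by
  refine lt_of_le_of_ne (integral_nonpos_of_ae (hneg.mono fun x hx => hx.le)) fun h => hν ?_
  have h0 : ∫ x, -f x ∂ν = 0 := by rw [integral_neg, h, neg_zero]
  have hz := (integral_eq_zero_iff_of_nonneg_ae
    (hneg.mono fun x hx => (neg_pos.2 hx).le) hf.neg).1 h0
  have hfalse : ∀ᵐ x ∂ν, False := by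
    filter_upwards [hneg, hz] with x hx hx'
    exact hx.ne (neg_eq_zero.1 hx')
  rwa [Filter.eventually_false_iff_eq_bot, ae_eq_bot] at hfalse

/-- Positivity of `-α₁(a)`: for `μ > 0`, `a ∈ (−2μ/9, 0) ∪ (0, 4μ/9)` and a
nonzero finite positive measure `ν` supported in `[2μ/3, ∞)`, the integral
of `β₁(a, s) = 27a²(3a − 2s)/s³` against `ν` is strictly negative. -/
theorem alpha_one_neg (μ a : ℝ) (hμ : 0 < μ)
    (ha : a ∈ Set.Ioo (-(2 * μ) / 9) 0 ∪ Set.Ioo 0 (4 * μ / 9))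
    (ν : Measure ℝ) [IsFiniteMeasure ν] (hν : ν ≠ 0)
    (hsupp : ν (Set.Iio (2 * μ / 3)) = 0) :
    ∫ s, 27 * a ^ 2 * (3 * a - 2 * s) / s ^ 3 ∂ν < 0 := by
  have ha0 : a ≠ 0 := by
    rcases ha with h | h
    exacts [h.2.ne, h.1.ne']
  have hlo : -(2 * μ) / 9 < a := by
    rcases ha with h | h
    · exact h.1
    · linarith [h.1]
  have hhi : a < 4 * μ / 9 := by
    rcases ha with h | h
    · linarith [h.2]
    · exact h.2
  have hc : 0 < 2 * μ / 3 := by positivity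
  have hs : ∀ᵐ s ∂ν, 2 * μ / 3 ≤ s := by
    rw [ae_iff]
    simpa only [not_le, Set.Iio_def] using hsupp
  have hneg : ∀ᵐ s ∂ν, 27 * a ^ 2 * (3 * a - 2 * s) / s ^ 3 < 0 := by
    filter_upwards [hs] with s hs
    have hs0 : 0 < s := hc.trans_le hs
    exact div_neg_of_neg_of_pos
      (mul_neg_of_pos_of_neg (by positivity) (by linarith)) (by positivity)
  refine integral_neg_of_ae_neg hν ?_ hneg
  refine Integrable.of_bound (Measurable.aestronglyMeasurable (by fun_prop))
    (81 * a ^ 2 / (2 * μ / 3) ^ 2) ?_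
  filter_upwards [hs, hneg] with s hs hn
  have hs0 : 0 < s := hc.trans_le hs
  rw [Real.norm_of_nonpos hn.le]
  calc -(27 * a ^ 2 * (3 * a - 2 * s) / s ^ 3)
      = 27 * a ^ 2 * (2 * s - 3 * a) / s ^ 3 := by ring
    _ ≤ 27 * a ^ 2 * (3 * s) / s ^ 3 := by gcongr; linarith
    _ = 81 * a ^ 2 / s ^ 2 := by field_simp; ring
    _ ≤ 81 * a ^ 2 / (2 * μ / 3) ^ 2 := by gcongr
end

section
/- Let μ > 0, let a ∈ ℝ with a ∈ (−2μ/9, 0) ∪ (0, 4μ/9), and let ν be a finite (positive) Borel measure on ℝ supported in [2μ/3, ∞). For each integer n ≥ 1 define αₙ := ∫ βₙ(a, s) dν(s), where βₙ(a, s) is the n-th Taylor coefficient in z at z = 0 of z ↦ H(z; s, a) = 27a²z(2s − 3a)/(27a³z − 27a²zs − (z−1)²s³). Then for every integer n ≥ 2, |αₙ| ≤ n·|α₁|. -/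
open MeasureTheory

/-- The crossing-symmetric dispersion kernel
`H(z; s, a) = 27a²z(2s − 3a)/(27a³z − 27a²zs − (z−1)²s³)`. -/
noncomputable def crossingKernel (a s : ℝ) (z : ℂ) : ℂ :=
  27 * (a : ℂ) ^ 2 * z * (2 * (s : ℂ) - 3 * (a : ℂ)) /
    (27 * (a : ℂ) ^ 3 * z - 27 * (a : ℂ) ^ 2 * z * (s : ℂ)
      - (z - 1) ^ 2 * (s : ℂ) ^ 3)

/-- The `n`-th Taylor coefficient `βₙ(a, s)` in `z` at `z = 0` of the
crossing-symmetric kernel `z ↦ H(z; s, a)`. -/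
noncomputable def betaCoeff (n : ℕ) (a s : ℝ) : ℂ :=
  iteratedDeriv n (crossingKernel a s) 0 / (n.factorial : ℂ)

/-- For unimodular `w` and `v`, the power series of `z / ((1 - wz)(1 - vz))` on the unit disc. -/
lemma hasSum_mul_inv_one_sub_mul {w v z : ℂ} (hw : ‖w‖ = 1) (hv : ‖v‖ = 1) (hz : ‖z‖ < 1) :
    HasSum (fun n : ℕ => z ^ (n + 1) * ∑ kl ∈ Finset.HasAntidiagonal.antidiagonal n, w ^ kl.1 * v ^ kl.2)
      (z * ((1 - w * z)⁻¹ * (1 - v * z)⁻¹)) := by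
  have hwz : ‖w * z‖ < 1 := by rwa [norm_mul, hw, one_mul]
  have hvz : ‖v * z‖ < 1 := by rwa [norm_mul, hv, one_mul]
  have hsw : Summable fun n : ℕ => ‖(w * z) ^ n‖ := by
    simpa only [norm_pow] using summable_geometric_of_lt_one (norm_nonneg _) hwz
  have hsv : Summable fun n : ℕ => ‖(v * z) ^ n‖ := by
    simpa only [norm_pow] using summable_geometric_of_lt_one (norm_nonneg _) hvz
  have hsum := (summable_norm_sum_mul_antidiagonal_of_summable_norm hsw hsv).of_norm.hasSum
  rw [← tsum_mul_tsum_eq_tsum_sum_antidiagonal_of_summable_norm hsw hsv,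
    tsum_geometric_of_norm_lt_one hwz, tsum_geometric_of_norm_lt_one hvz] at hsum
  refine (hsum.mul_left z).congr_fun ?_
  intro n
  rw [pow_succ', mul_assoc, Finset.mul_sum]
  congr 1
  refine Finset.sum_congr rfl fun kl hkl => ?_
  rw [← Finset.HasAntidiagonal.mem_antidiagonal.mp hkl, pow_add]
  ring

/-- The Taylor coefficients at `0` of a function given near `0` by a convergent power series. -/
lemma iteratedDeriv_div_factorial_of_hasSum {f : ℂ → ℂ} {b : ℕ → ℂ}
    (h : ∀ᶠ z in nhds (0 : ℂ), HasSum (fun n => z ^ n * b n) (f z)) (n : ℕ) :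
    iteratedDeriv n f 0 / (n.factorial : ℂ) = b n := by
  have hf : HasFPowerSeriesAt f (FormalMultilinearSeries.ofScalars ℂ b) 0 := by
    rw [hasFPowerSeriesAt_iff]
    simpa [FormalMultilinearSeries.coeff_ofScalars] using h
  have heq := congrArg (fun p => p.coeff n)
    (hf.analyticAt.hasFPowerSeriesAt.eq_formalMultilinearSeries hf)
  simpa [FormalMultilinearSeries.coeff_ofScalars] using heq

/-- The real number `β₁(a, s) = 27a²(3a − 2s)/s³`. -/
noncomputable def betaOne (a s : ℝ) : ℝ := 27 * a ^ 2 * (3 * a - 2 * s) / s ^ 3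

lemma betaCoeff_succ_eq {a s : ℝ} (hs : s ≠ 0) {w v : ℂ} (hw : ‖w‖ = 1) (hv : ‖v‖ = 1)
    (hwv : w * v = 1) (hadd : w + v = 2 - 27 * (a : ℂ) ^ 2 * (s - a) / s ^ 3) (n : ℕ) :
    betaCoeff (n + 1) a s =
      betaOne a s * ∑ kl ∈ Finset.HasAntidiagonal.antidiagonal n, w ^ kl.1 * v ^ kl.2 := by
  have hs' : (s : ℂ) ≠ 0 := by exact_mod_cast hs
  let b : ℕ → ℂ := fun n => Nat.casesOn n 0 fun m =>
    betaOne a s * ∑ kl ∈ Finset.HasAntidiagonal.antidiagonal m, w ^ kl.1 * v ^ kl.2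
  refine iteratedDeriv_div_factorial_of_hasSum (b := b) ?_ (n + 1)
  filter_upwards [Metric.ball_mem_nhds (0 : ℂ) one_pos] with z hz
  rw [mem_ball_zero_iff] at hz
  have hsum := (hasSum_mul_inv_one_sub_mul hw hv hz).mul_left (betaOne a s : ℂ)
  have hval : crossingKernel a s z =
      betaOne a s * (z * ((1 - w * z)⁻¹ * (1 - v * z)⁻¹)) := by
    have hden : 27 * (a : ℂ) ^ 3 * z - 27 * (a : ℂ) ^ 2 * z * s - (z - 1) ^ 2 * (s : ℂ) ^ 3 =
        -(s : ℂ) ^ 3 * ((1 - w * z) * (1 - v * z)) := by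
      have hprod : (1 - w * z) * (1 - v * z) = 1 - (w + v) * z + w * v * z ^ 2 := by ring
      rw [hprod, hadd, hwv]
      field_simp
      ring
    rw [crossingKernel, hden, ← mul_inv, betaOne, div_eq_mul_inv, mul_inv]
    push_cast
    rw [inv_neg]
    ring
  have hb : b 0 = 0 := rfl
  rw [hval, ← hasSum_nat_add_iff' 1, Finset.sum_range_one, hb, mul_zero, sub_zero]
  exact hsum.congr_fun fun m => mul_left_comm _ _ _

lemma exists_unimodular_pair {t : ℝ} (h₀ : 0 ≤ t) (h₄ : t ≤ 4) :
    ∃ w v : ℂ, ‖w‖ = 1 ∧ ‖v‖ = 1 ∧ w * v = 1 ∧ w + v = 2 - (t : ℂ) := by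
  set θ := Real.arccos (1 - t / 2)
  have hcos : Real.cos θ = 1 - t / 2 := Real.cos_arccos (by linarith) (by linarith)
  refine ⟨Complex.exp (θ * Complex.I), Complex.exp (-θ * Complex.I),
    Complex.norm_exp_ofReal_mul_I θ, ?_, ?_, ?_⟩
  · simpa using Complex.norm_exp_ofReal_mul_I (-θ)
  · rw [← Complex.exp_add]; simp
  · rw [← Complex.two_cos, ← Complex.ofReal_cos, hcos]
    push_cast
    ring

/-- For `-s/3 ≤ a ≤ 2s/3` the zeros of the denominator of the kernel lie on the unit circle. -/
lemma exists_unimodular_factorization {a s : ℝ} (hs : 0 < s) (hl : -s ≤ 3 * a)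
    (hu : 3 * a ≤ 2 * s) :
    ∃ w v : ℂ, ‖w‖ = 1 ∧ ‖v‖ = 1 ∧ w * v = 1 ∧
      w + v = 2 - 27 * (a : ℂ) ^ 2 * (s - a) / s ^ 3 := by
  have h₀ : 0 ≤ 27 * a ^ 2 * (s - a) / s ^ 3 :=
    div_nonneg (mul_nonneg (by positivity) (by linarith)) (by positivity)
  have h₄ : 27 * a ^ 2 * (s - a) / s ^ 3 ≤ 4 := by
    rw [div_le_iff₀ (by positivity)]
    nlinarith [mul_nonneg (sq_nonneg (3 * a - 2 * s)) (by linarith : 0 ≤ 3 * a + s)]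
  simpa using exists_unimodular_pair h₀ h₄

lemma betaCoeff_one_eq {a s : ℝ} (hs : 0 < s) (hl : -s ≤ 3 * a) (hu : 3 * a ≤ 2 * s) :
    betaCoeff 1 a s = betaOne a s := by
  obtain ⟨w, v, hw, hv, hwv, hadd⟩ := exists_unimodular_factorization hs hl hu
  simpa using betaCoeff_succ_eq hs.ne' hw hv hwv hadd 0

lemma norm_betaCoeff_le {a s : ℝ} (hs : 0 < s) (hl : -s ≤ 3 * a) (hu : 3 * a ≤ 2 * s)
    {n : ℕ} (hn : n ≠ 0) : ‖betaCoeff n a s‖ ≤ n * |betaOne a s| := by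
  obtain ⟨w, v, hw, hv, hwv, hadd⟩ := exists_unimodular_factorization hs hl hu
  obtain ⟨m, rfl⟩ := Nat.exists_eq_succ_of_ne_zero hn
  rw [Nat.succ_eq_add_one, betaCoeff_succ_eq hs.ne' hw hv hwv hadd, norm_mul, mul_comm,
    Complex.norm_real, Real.norm_eq_abs]
  refine mul_le_mul_of_nonneg_right ((norm_sum_le _ _).trans ?_) (abs_nonneg _)
  simp [hw, hv]

lemma betaOne_nonpos {a s : ℝ} (hs : 0 < s) (hu : 3 * a ≤ 2 * s) : betaOne a s ≤ 0 :=
  div_nonpos_of_nonpos_of_nonneg (mul_nonpos_of_nonneg_of_nonpos (by positivity) (by linarith))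
    (by positivity)

lemma abs_betaOne_le {a s m : ℝ} (hm : 0 < m) (hms : m ≤ s) (hl : -s ≤ 3 * a)
    (hu : 3 * a ≤ 2 * s) : |betaOne a s| ≤ 81 * a ^ 2 / m ^ 2 := by
  have hs : 0 < s := hm.trans_le hms
  rw [abs_of_nonpos (betaOne_nonpos hs hu)]
  calc -betaOne a s = 27 * a ^ 2 * (2 * s - 3 * a) / s ^ 3 := by rw [betaOne]; ring
    _ ≤ 27 * a ^ 2 * (3 * s) / s ^ 3 := by gcongr; linarith
    _ = 81 * a ^ 2 / s ^ 2 := by field_simp; ring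
    _ ≤ 81 * a ^ 2 / m ^ 2 := by gcongr

/-- Bieberbach-type bound on the amplitude's Taylor coefficients: for
`μ > 0`, `a ∈ (−2μ/9, 0) ∪ (0, 4μ/9)` and a finite positive measure `ν`
supported in `[2μ/3, ∞)`, setting `αₙ = ∫ βₙ(a, s) dν(s)`, one has
`|αₙ| ≤ n·|α₁|` for every `n ≥ 2`. -/
theorem alpha_coeff_bound (μ a : ℝ) (hμ : 0 < μ)
    (ha : a ∈ Set.Ioo (-(2 * μ) / 9) 0 ∪ Set.Ioo 0 (4 * μ / 9))
    (ν : Measure ℝ) [IsFiniteMeasure ν]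
    (hsupp : ν (Set.Iio (2 * μ / 3)) = 0) :
    ∀ n : ℕ, 2 ≤ n →
      ‖∫ s, betaCoeff n a s ∂ν‖ ≤ n * ‖∫ s, betaCoeff 1 a s ∂ν‖ := by
  intro n hn
  have hal : -(2 * μ) / 9 < a ∧ a < 4 * μ / 9 := by
    rcases ha with ⟨h₁, h₂⟩ | ⟨h₁, h₂⟩ <;> constructor <;> linarith
  have hae : ∀ᵐ s ∂ν, 2 * μ / 3 ≤ s ∧ 0 < s ∧ -s ≤ 3 * a ∧ 3 * a ≤ 2 * s := by
    have hmem : ∀ᵐ s ∂ν, s ∉ Set.Iio (2 * μ / 3) := measure_eq_zero_iff_ae_notMem.mp hsupp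
    filter_upwards [hmem] with s hs
    rw [Set.mem_Iio, not_lt] at hs
    refine ⟨hs, ?_, ?_, ?_⟩ <;> linarith [hal.1, hal.2]
  have hint : Integrable (betaOne a) ν := by
    refine Integrable.of_bound (C := 81 * a ^ 2 / (2 * μ / 3) ^ 2) ?_ ?_
    · unfold betaOne
      exact Measurable.aestronglyMeasurable (by fun_prop)
    · filter_upwards [hae] with s hs
      exact abs_betaOne_le (by positivity) hs.1 hs.2.2.1 hs.2.2.2
  have hone : ∫ s, betaCoeff 1 a s ∂ν = ((∫ s, betaOne a s ∂ν : ℝ) : ℂ) := by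
    rw [← integral_complex_ofReal]
    refine integral_congr_ae ?_
    filter_upwards [hae] with s hs
    exact betaCoeff_one_eq hs.2.1 hs.2.2.1 hs.2.2.2
  have habs : ∫ s, |betaOne a s| ∂ν = |∫ s, betaOne a s ∂ν| := by
    rw [abs_of_nonpos, ← integral_neg]
    · refine integral_congr_ae ?_
      filter_upwards [hae] with s hs
      exact abs_of_nonpos (betaOne_nonpos hs.2.1 hs.2.2.2)
    · refine integral_nonpos_of_ae ?_
      filter_upwards [hae] with s hs
      exact betaOne_nonpos hs.2.1 hs.2.2.2
  calc ‖∫ s, betaCoeff n a s ∂ν‖ ≤ ∫ s, n * |betaOne a s| ∂ν := by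
        refine norm_integral_le_of_norm_le (hint.abs.const_mul _) ?_
        filter_upwards [hae] with s hs
        exact norm_betaCoeff_le hs.2.1 hs.2.2.1 hs.2.2.2 (by omega)
    _ = n * ‖∫ s, betaCoeff 1 a s ∂ν‖ := by
        rw [integral_const_mul, habs, hone, Complex.norm_real, Real.norm_eq_abs]
end

section
/- Let μ > 0, let a ∈ ℝ with a ∈ (−2μ/9, 0) ∪ (0, 4μ/9), and let ν be a finite (positive) Borel measure on ℝ supported in [2μ/3, ∞). Then for every z ∈ ℂ with |z| < 1, |∫ H(z; s, a) dν(s)| ≤ |∫ β₁(a, s) dν(s)| · |z|/(1 − |z|)², where H(z; s, a) = 27a²z(2s − 3a)/(27a³z − 27a²zs − (z−1)²s³) and β₁(a, s) = 27a²(3a − 2s)/s³. -/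
open MeasureTheory

/-- The quadratic `1 - 2cz + z²` with `|c| ≤ 1` has both roots on the unit circle, hence is bounded
below by `(1 - ‖z‖)²` in the unit disc. -/
lemma one_sub_norm_sq_le_norm_quadratic {c : ℝ} (hc : c ^ 2 ≤ 1) {z : ℂ} (hz : ‖z‖ < 1) :
    (1 - ‖z‖) ^ 2 ≤ ‖1 - 2 * (c : ℂ) * z + z ^ 2‖ := by
  set d : ℝ := Real.sqrt (1 - c ^ 2)
  have hd : d ^ 2 = 1 - c ^ 2 := Real.sq_sqrt (by linarith)
  have hdC : (d : ℂ) ^ 2 = 1 - (c : ℂ) ^ 2 := by exact_mod_cast hd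
  have factor : 1 - 2 * (c : ℂ) * z + z ^ 2
      = ((c + d * Complex.I) - z) * ((c + (-d : ℝ) * Complex.I) - z) := by
    push_cast
    linear_combination (-hdC) - (d : ℂ) ^ 2 * (- Complex.I_sq)
  have dist_root (e : ℝ) (he : e ^ 2 = 1 - c ^ 2) : 1 - ‖z‖ ≤ ‖(c + e * Complex.I) - z‖ := by
    have hnorm : ‖(c : ℂ) + e * Complex.I‖ = 1 := by
      rw [Complex.norm_add_mul_I, he]
      simp
    simpa [hnorm] using norm_sub_norm_le ((c : ℂ) + e * Complex.I) z
  rw [factor, norm_mul, sq]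
  exact mul_le_mul (dist_root d hd) (dist_root (-d) (by rw [neg_sq, hd]))
    (by linarith) (norm_nonneg _)

/-- The kernel is its first Taylor coefficient times `z / (1 - 2cz + z²)`, where
`c = 1 - 27a²(s - a)/(2s³)`. -/
lemma crossingKernel_eq {a s : ℝ} (hs : s ≠ 0) (z : ℂ) :
    crossingKernel a s z = ((27 * a ^ 2 * (3 * a - 2 * s) / s ^ 3 : ℝ) : ℂ) *
      (z / (1 - 2 * ((1 - 27 * a ^ 2 * (s - a) / (2 * s ^ 3) : ℝ) : ℂ) * z + z ^ 2)) := by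
  have hsC : (s : ℂ) ≠ 0 := by exact_mod_cast hs
  have hden : 27 * (a : ℂ) ^ 3 * z - 27 * (a : ℂ) ^ 2 * z * s - (z - 1) ^ 2 * (s : ℂ) ^ 3
      = -(s : ℂ) ^ 3 *
        (1 - 2 * ((1 - 27 * a ^ 2 * (s - a) / (2 * s ^ 3) : ℝ) : ℂ) * z + z ^ 2) := by
    push_cast
    field_simp
    ring
  rw [crossingKernel, hden, Complex.ofReal_div, div_mul_div_comm, neg_mul, div_neg, ← neg_div]
  congr 1
  · push_cast
    ring
  · push_cast
    ring

lemma sq_kernel_parameter_le_one {a s : ℝ} (hs : 0 < s) (hl : -s ≤ 3 * a) (hu : 3 * a ≤ 2 * s) :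
    (1 - 27 * a ^ 2 * (s - a) / (2 * s ^ 3)) ^ 2 ≤ 1 := by
  have hw0 : 0 ≤ 27 * a ^ 2 * (s - a) / (2 * s ^ 3) :=
    div_nonneg (mul_nonneg (by positivity) (by linarith)) (by positivity)
  have hw2 : 27 * a ^ 2 * (s - a) / (2 * s ^ 3) ≤ 2 := by
    rw [div_le_iff₀ (by positivity)]
    nlinarith [mul_nonneg (by linarith : 0 ≤ s + 3 * a) (sq_nonneg (2 * s - 3 * a))]
  nlinarith

lemma norm_crossingKernel_le {a s : ℝ} (hs : 0 < s) (hl : -s ≤ 3 * a) (hu : 3 * a ≤ 2 * s)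
    {z : ℂ} (hz : ‖z‖ < 1) :
    ‖crossingKernel a s z‖ ≤
      |27 * a ^ 2 * (3 * a - 2 * s) / s ^ 3| * (‖z‖ / (1 - ‖z‖) ^ 2) := by
  rw [crossingKernel_eq hs.ne', norm_mul, Complex.norm_real, Real.norm_eq_abs, norm_div]
  have hpos : 0 < (1 - ‖z‖) ^ 2 := pow_pos (by linarith) 2
  gcongr
  exact one_sub_norm_sq_le_norm_quadratic (sq_kernel_parameter_le_one hs hl hu) hz

lemma taylorCoeff_nonpos {a s : ℝ} (hs : 0 < s) (hu : 3 * a ≤ 2 * s) :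
    27 * a ^ 2 * (3 * a - 2 * s) / s ^ 3 ≤ 0 :=
  div_nonpos_of_nonpos_of_nonneg
    (mul_nonpos_of_nonneg_of_nonpos (by positivity) (by linarith)) (by positivity)

lemma abs_taylorCoeff_le {a s : ℝ} (hs : 0 < s) (hl : -s ≤ 3 * a) (hu : 3 * a ≤ 2 * s) :
    |27 * a ^ 2 * (3 * a - 2 * s) / s ^ 3| ≤ 36 := by
  rw [abs_of_nonpos (taylorCoeff_nonpos hs hu), ← neg_div, div_le_iff₀ (by positivity)]
  have hsq : 9 * a ^ 2 ≤ 4 * s ^ 2 := by nlinarith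
  nlinarith [mul_nonneg (sub_nonneg.2 hsq) hs.le,
    mul_nonneg (sq_nonneg a) (by linarith : 0 ≤ s + 3 * a)]

/-- Upper bound on the subtracted amplitude: for `μ > 0`,
`a ∈ (−2μ/9, 0) ∪ (0, 4μ/9)` and a finite positive measure `ν` supported in
`[2μ/3, ∞)`, for every `z` in the open unit disc,
`|∫ H(z; s, a) dν(s)| ≤ |∫ β₁(a, s) dν(s)| · |z|/(1 − |z|)²`,
where `β₁(a, s) = 27a²(3a − 2s)/s³`. -/
theorem amplitude_upper_bound (μ a : ℝ) (hμ : 0 < μ)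
    (ha : a ∈ Set.Ioo (-(2 * μ) / 9) 0 ∪ Set.Ioo 0 (4 * μ / 9))
    (ν : Measure ℝ) [IsFiniteMeasure ν]
    (hsupp : ν (Set.Iio (2 * μ / 3)) = 0) :
    ∀ z : ℂ, ‖z‖ < 1 →
      ‖∫ s, crossingKernel a s z ∂ν‖ ≤
        |∫ s, 27 * a ^ 2 * (3 * a - 2 * s) / s ^ 3 ∂ν| *
          (‖z‖ / (1 - ‖z‖) ^ 2) := by
  intro z hz
  have hsupp_ae : ∀ᵐ s ∂ν, 0 < s ∧ -s ≤ 3 * a ∧ 3 * a ≤ 2 * s := by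
    have hmem : ∀ᵐ s ∂ν, s ∉ Set.Iio (2 * μ / 3) := measure_eq_zero_iff_ae_notMem.1 hsupp
    filter_upwards [hmem] with s hs
    rw [Set.mem_Iio, not_lt] at hs
    rcases ha with ⟨h1, h2⟩ | ⟨h1, h2⟩ <;> refine ⟨?_, ?_, ?_⟩ <;> linarith
  have hint : Integrable (fun s : ℝ => 27 * a ^ 2 * (3 * a - 2 * s) / s ^ 3) ν := by
    refine Integrable.of_bound (C := 36) (Measurable.aestronglyMeasurable (by fun_prop)) ?_
    filter_upwards [hsupp_ae] with s hs
    exact abs_taylorCoeff_le hs.1 hs.2.1 hs.2.2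
  have habs : ∫ s, |27 * a ^ 2 * (3 * a - 2 * s) / s ^ 3| ∂ν
      = -∫ s, 27 * a ^ 2 * (3 * a - 2 * s) / s ^ 3 ∂ν := by
    rw [← integral_neg]
    refine integral_congr_ae ?_
    filter_upwards [hsupp_ae] with s hs
    exact abs_of_nonpos (taylorCoeff_nonpos hs.1 hs.2.2)
  calc ‖∫ s, crossingKernel a s z ∂ν‖
      ≤ ∫ s, |27 * a ^ 2 * (3 * a - 2 * s) / s ^ 3| * (‖z‖ / (1 - ‖z‖) ^ 2) ∂ν := by
        refine norm_integral_le_of_norm_le (hint.abs.mul_const _) ?_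
        filter_upwards [hsupp_ae] with s hs
        exact norm_crossingKernel_le hs.1 hs.2.1 hs.2.2 hz
    _ = (-∫ s, 27 * a ^ 2 * (3 * a - 2 * s) / s ^ 3 ∂ν) * (‖z‖ / (1 - ‖z‖) ^ 2) := by
        rw [integral_mul_const, habs]
    _ ≤ _ := mul_le_mul_of_nonneg_right (neg_le_abs _) (by positivity)
end

section
/- Let μ > 0, let a ∈ ℝ with a ∈ (−2μ/9, 0) ∪ (0, 4μ/9), and let ν be a finite (positive) Borel measure on ℝ supported in [2μ/3, ∞). Then for every real z with −1 < z < 1, |∫ H(z; s, a) dν(s)| ≥ |∫ β₁(a, s) dν(s)| · |z|/(1 + |z|)², where H(z; s, a) = 27a²z(2s − 3a)/(27a³z − 27a²zs − (z−1)²s³) and β₁(a, s) = 27a²(3a − 2s)/s³. -/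
open MeasureTheory

/-- The kernel divided by `-z`, as a real function: `27a²(2s − 3a)/((z−1)²s³ + 27a²z(s − a))`. -/
noncomputable def reducedKernel (a z s : ℝ) : ℝ :=
  27 * a ^ 2 * (2 * s - 3 * a) / ((z - 1) ^ 2 * s ^ 3 + 27 * a ^ 2 * z * (s - a))

theorem crossingKernel_ofReal (a s z : ℝ) :
    crossingKernel a s (z : ℂ) = ((-z * reducedKernel a z s : ℝ) : ℂ) := by
  have hreal : -z * reducedKernel a z s = 27 * a ^ 2 * z * (2 * s - 3 * a) /
      (27 * a ^ 3 * z - 27 * a ^ 2 * z * s - (z - 1) ^ 2 * s ^ 3) := by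
    rw [reducedKernel, ← mul_div_assoc, ← neg_div_neg_eq]
    congr 1 <;> ring
  rw [hreal, crossingKernel]
  push_cast
  rfl

/-- The coefficient `27a²(s − a)/s³` is at most `4`, in cleared form. -/
theorem mul_sub_le_four_mul_cube {a s : ℝ} (h : 0 ≤ s + 3 * a) :
    27 * a ^ 2 * (s - a) ≤ 4 * s ^ 3 := by
  linear_combination mul_nonneg (sq_nonneg (2 * s - 3 * a)) h

theorem kernelDenominator_le {a s z : ℝ} (has : a ≤ s) (hsa : 0 ≤ s + 3 * a) :
    (z - 1) ^ 2 * s ^ 3 + 27 * a ^ 2 * z * (s - a) ≤ (1 + |z|) ^ 2 * s ^ 3 := by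
  have h4 := mul_sub_le_four_mul_cube hsa
  have h0 : 0 ≤ 27 * a ^ 2 * (s - a) := mul_nonneg (by positivity) (sub_nonneg.2 has)
  rcases le_total 0 z with hz | hz
  · rw [abs_of_nonneg hz]
    linear_combination z * h4
  · rw [abs_of_nonpos hz]
    linear_combination mul_nonneg (neg_nonneg.2 hz) h0

theorem le_kernelDenominator {a s z : ℝ} (has : a ≤ s) (hsa : 0 ≤ s + 3 * a) :
    (1 - |z|) ^ 2 * s ^ 3 ≤ (z - 1) ^ 2 * s ^ 3 + 27 * a ^ 2 * z * (s - a) := by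
  have h4 := mul_sub_le_four_mul_cube hsa
  have h0 : 0 ≤ 27 * a ^ 2 * (s - a) := mul_nonneg (by positivity) (sub_nonneg.2 has)
  rcases le_total 0 z with hz | hz
  · rw [abs_of_nonneg hz]
    linear_combination z * h0
  · rw [abs_of_nonpos hz]
    linear_combination mul_le_mul_of_nonneg_left h4 (neg_nonneg.2 hz)

/-- On `[m, ∞)` the function `27a²(2s − 3a)/s³` is bounded, hence integrable. -/
theorem integrable_firstCoefficient {a m : ℝ} (hm : 0 < m) {ν : Measure ℝ} [IsFiniteMeasure ν]
    (hν : ∀ᵐ s ∂ν, m ≤ s ∧ |a| ≤ s) :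
    Integrable (fun s => 27 * a ^ 2 * (2 * s - 3 * a) / s ^ 3) ν := by
  refine Integrable.of_bound (C := 27 * a ^ 2 * 5 / m ^ 2)
    (by fun_prop : Measurable _).aestronglyMeasurable ?_
  filter_upwards [hν] with s hs
  have hs0 : 0 < s := hm.trans_le hs.1
  have habs : |2 * s - 3 * a| ≤ 5 * s := by
    obtain ⟨h1, h2⟩ := abs_le.1 hs.2
    exact abs_le.2 ⟨by linarith, by linarith⟩
  rw [Real.norm_eq_abs, abs_div, abs_mul, abs_of_nonneg (by positivity : 0 ≤ 27 * a ^ 2),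
    abs_of_pos (pow_pos hs0 3)]
  calc 27 * a ^ 2 * |2 * s - 3 * a| / s ^ 3 ≤ 27 * a ^ 2 * (5 * s) / s ^ 3 := by gcongr
    _ = 27 * a ^ 2 * 5 / s ^ 2 := by field_simp
    _ ≤ 27 * a ^ 2 * 5 / m ^ 2 := by gcongr; exact hs.1

/-- Koebe-type lower bound on the subtracted amplitude: for `μ > 0`,
`a ∈ (−2μ/9, 0) ∪ (0, 4μ/9)` and a finite positive measure `ν` supported in
`[2μ/3, ∞)`, for every real `z` with `−1 < z < 1`,
`|∫ H(z; s, a) dν(s)| ≥ |∫ β₁(a, s) dν(s)| · |z|/(1 + |z|)²`,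
where `β₁(a, s) = 27a²(3a − 2s)/s³`. -/
theorem amplitude_lower_bound (μ a : ℝ) (hμ : 0 < μ)
    (ha : a ∈ Set.Ioo (-(2 * μ) / 9) 0 ∪ Set.Ioo 0 (4 * μ / 9))
    (ν : Measure ℝ) [IsFiniteMeasure ν]
    (hsupp : ν (Set.Iio (2 * μ / 3)) = 0) :
    ∀ z : ℝ, -1 < z → z < 1 →
      |∫ s, 27 * a ^ 2 * (3 * a - 2 * s) / s ^ 3 ∂ν| *
          (|z| / (1 + |z|) ^ 2) ≤
        ‖∫ s, crossingKernel a s (z : ℂ) ∂ν‖ := by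
  intro z hz hz'
  have hzabs : 0 < 1 - |z| := sub_pos.2 (abs_lt.2 ⟨hz, hz'⟩)
  have hlo : -(2 * μ) / 9 < a := by
    rcases ha with h | h
    · exact h.1
    · linarith [h.1]
  have hhi : a < 4 * μ / 9 := by
    rcases ha with h | h
    · linarith [h.2]
    · exact h.2
  have hge : ∀ᵐ s ∂ν, 2 * μ / 3 ≤ s := by
    filter_upwards [measure_eq_zero_iff_ae_notMem.1 hsupp] with s hs
    exact not_lt.1 hs
  set F : ℝ → ℝ := fun s => 27 * a ^ 2 * (2 * s - 3 * a) / s ^ 3 with hF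
  have hFint : Integrable F ν := by
    refine integrable_firstCoefficient (m := 2 * μ / 3) (by positivity) ?_
    filter_upwards [hge] with s hs
    exact ⟨hs, abs_le.2 ⟨by linarith, by linarith⟩⟩
  have hbounds : ∀ᵐ s ∂ν, 0 ≤ F s ∧ F s / (1 + |z|) ^ 2 ≤ reducedKernel a z s ∧
      reducedKernel a z s ≤ F s / (1 - |z|) ^ 2 := by
    filter_upwards [hge] with s hs
    have hs0 : 0 < s := by linarith
    have hnum : 0 ≤ 27 * a ^ 2 * (2 * s - 3 * a) :=
      mul_nonneg (by positivity) (by linarith)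
    have hupper := kernelDenominator_le (a := a) (s := s) (z := z) (by linarith) (by linarith)
    have hlower := le_kernelDenominator (a := a) (s := s) (z := z) (by linarith) (by linarith)
    have hpos : 0 < (1 - |z|) ^ 2 * s ^ 3 := by positivity
    refine ⟨div_nonneg hnum (by positivity), ?_, ?_⟩
    · rw [hF, div_div, mul_comm (s ^ 3)]
      exact div_le_div_of_nonneg_left hnum (hpos.trans_le hlower) hupper
    · rw [hF, div_div, mul_comm (s ^ 3)]
      exact div_le_div_of_nonneg_left hnum hpos hlower
  have hKint : Integrable (reducedKernel a z) ν := by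
    refine (hFint.div_const ((1 - |z|) ^ 2)).mono' ?_ ?_
    · unfold reducedKernel
      exact (by fun_prop : Measurable _).aestronglyMeasurable
    · filter_upwards [hbounds] with s hs
      rw [Real.norm_of_nonneg ((div_nonneg hs.1 (by positivity)).trans hs.2.1)]
      exact hs.2.2
  have hle : (∫ s, F s ∂ν) / (1 + |z|) ^ 2 ≤ ∫ s, reducedKernel a z s ∂ν := by
    rw [← integral_div]
    exact integral_mono_ae (hFint.div_const _) hKint (hbounds.mono fun s hs => hs.2.1)
  have hF0 : 0 ≤ ∫ s, F s ∂ν := integral_nonneg_of_ae (hbounds.mono fun s hs => hs.1)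
  have hβ : ∫ s, 27 * a ^ 2 * (3 * a - 2 * s) / s ^ 3 ∂ν = -∫ s, F s ∂ν := by
    rw [← integral_neg]
    congr 1 with s
    rw [hF]
    ring
  have hH : ‖∫ s, crossingKernel a s (z : ℂ) ∂ν‖ = |z| * |∫ s, reducedKernel a z s ∂ν| := by
    simp_rw [crossingKernel_ofReal]
    rw [integral_complex_ofReal, Complex.norm_real, integral_const_mul, Real.norm_eq_abs,
      abs_mul, abs_neg]
  rw [hβ, abs_neg, abs_of_nonneg hF0, hH]
  calc (∫ s, F s ∂ν) * (|z| / (1 + |z|) ^ 2) = |z| * ((∫ s, F s ∂ν) / (1 + |z|) ^ 2) := by ring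
    _ ≤ |z| * |∫ s, reducedKernel a z s ∂ν| := by
      gcongr
      exact hle.trans (le_abs_self _)
end

section
/- Let μ > 0 and let W₀₁, W₁₀ ∈ ℝ. Suppose that W₁₀ + a·W₀₁ > 0 for every a ∈ ℝ with −2μ/9 < a < 4μ/9. Then W₁₀ > 0 and −9/(4μ) ≤ W₀₁/W₁₀ ≤ 9/(2μ). -/
/-- Two-sided bound on the ratio of Wilson coefficients: if `μ > 0` and
`W₁₀ + a·W₀₁ > 0` for every `a ∈ (−2μ/9, 4μ/9)`, then `W₁₀ > 0` and
`−9/(4μ) ≤ W₀₁/W₁₀ ≤ 9/(2μ)`. -/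
theorem wilson_ratio_bound (μ W01 W10 : ℝ) (hμ : 0 < μ)
    (hpos : ∀ a : ℝ, -(2 * μ) / 9 < a → a < 4 * μ / 9 →
      W10 + a * W01 > 0) :
    W10 > 0 ∧ -9 / (4 * μ) ≤ W01 / W10 ∧ W01 / W10 ≤ 9 / (2 * μ) := by
  have hW : 0 < W10 := by simpa using hpos 0 (by linarith) (by linarith)
  -- A violated bound would put the zero `-W10 / W01` of the affine function inside the interval.
  refine ⟨hW, ?_, ?_⟩
  · rw [div_le_div_iff₀ (by positivity) hW]
    by_contra! h
    have hneg : W01 < 0 := by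
      by_contra! h0
      nlinarith [mul_nonneg h0 hμ.le]
    have hroot : 0 < -W10 / W01 := div_pos_of_neg_of_neg (by linarith) hneg
    have := hpos (-W10 / W01) (by linarith) (by rw [div_lt_iff_of_neg hneg]; linarith)
    rw [div_mul_cancel₀ _ hneg.ne] at this
    linarith
  · rw [div_le_div_iff₀ hW (by positivity)]
    by_contra! h
    have hW01 : 0 < W01 := by
      by_contra! h0
      nlinarith [mul_nonneg (neg_nonneg.2 h0) hμ.le]
    have hroot : -W10 / W01 < 0 := div_neg_of_neg_of_pos (by linarith) hW01
    have := hpos (-W10 / W01) (by rw [lt_div_iff₀ hW01]; linarith) (by linarith)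
    rw [div_mul_cancel₀ _ hW01.ne'] at this
    linarith
end

section
/- Let μ > 0, let a ∈ ℝ with −2μ/9 < a < 2μ/3, and let s ∈ ℝ with s > 2μ/3. Then s − a > 0 and ξ(s, a) := (s/(s − 2μ/3))² · (1 + 4a/(s − a)) ≥ 1. -/
/-- Key step of the positivity lemma: for `μ > 0`, `−2μ/9 < a < 2μ/3` and
`s > 2μ/3`, one has `s − a > 0` and
`ξ(s, a) = (s/(s − 2μ/3))² (1 + 4a/(s − a)) ≥ 1`. -/
theorem xi_ge_one (μ a s : ℝ) (hμ : 0 < μ)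
    (ha₁ : -(2 * μ) / 9 < a) (ha₂ : a < 2 * μ / 3)
    (hs : 2 * μ / 3 < s) :
    0 < s - a ∧ 1 ≤ (s / (s - 2 * μ / 3)) ^ 2 * (1 + 4 * a / (s - a)) := by
  have hsa : 0 < s - a := by linarith
  refine ⟨hsa, ?_⟩
  obtain ⟨m, rfl⟩ : ∃ m, μ = 3 * m / 2 := ⟨2 * μ / 3, by ring⟩
  have hm : 2 * (3 * m / 2) / 3 = m := by ring
  rw [hm] at hs ⊢
  have hm0 : 0 < m := by linarith
  have hsm : 0 < s - m := by linarith
  have hs0 : 0 < s := by linarith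
  have ham : 0 < a + m / 3 := by linarith
  have hξ : (s / (s - m)) ^ 2 * (1 + 4 * a / (s - a))
      = s ^ 2 * (s + 3 * a) / ((s - m) ^ 2 * (s - a)) := by
    have h₁ := hsa.ne'
    have h₂ := hsm.ne'
    field_simp
    ring
  rw [hξ, one_le_div (by positivity), ← sub_nonneg]
  have hdiff : s ^ 2 * (s + 3 * a) - (s - m) ^ 2 * (s - a)
      = (a + m / 3) * (3 * s ^ 2 + (s - m) ^ 2)
        + (s - m) * (2 * m * s / 3 + m ^ 2 / 3) := by ring
  rw [hdiff]
  positivity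
end
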